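/- arXiv:1809.06826 — 4 statements merged into one kernel-verified Lean document; each statement's English description precedes it below -/
import Mathlib

section
/- The pair (U,P) has H-growth if and only if there exists a nondecreasing function M : ℝ₊ → [1,∞) such that for all (t,s) ∈ Δ and x ∈ X: h₁(s)‖U(t,s)P₁(s)x‖ ≤ M(s)h₁(t)‖P₁(s)x‖, h₂(s)‖P₂(s)x‖ ≤ M(t)h₂(t)‖U(t,s)P₂(s)x‖, h₃(s)‖U(t,s)P₃(s)x‖ ≤ M(s)h₃(t)‖P₃(s)x‖, and h₄(s)‖P₃(s)x‖ ≤ M(t)h₄(t)‖U(t,s)P₃(s)x‖. -/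
open Filter

/-- `M : ℝ₊ → [1,∞)` nondecreasing, encoded on `ℝ` with conditions on `ℝ₊`. -/
def NondecOne (M : ℝ → ℝ) : Prop :=
  (∀ s t : ℝ, 0 ≤ s → s ≤ t → M s ≤ M t) ∧ ∀ t : ℝ, 0 ≤ t → 1 ≤ M t

/-- A growth rate: nondecreasing `h : ℝ₊ → [1,∞)` with `h(t) → ∞`. -/
def GrowthRate (h : ℝ → ℝ) : Prop :=
  NondecOne h ∧ Tendsto h atTop atTop

/-- A locally bounded function on `ℝ₊` has a nondecreasing majorant with values in `[1,∞)`. -/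
theorem exists_nondecOne_majorant {f : ℝ → ℝ}
    (hf : ∀ t : ℝ, 0 ≤ t → ∃ C : ℝ, ∀ s : ℝ, 0 ≤ s → s ≤ t → f s ≤ C) :
    ∃ K : ℝ → ℝ, NondecOne K ∧ ∀ t : ℝ, 0 ≤ t → f t ≤ K t := by
  have bdd : ∀ t : ℝ, 0 ≤ t → BddAbove (f '' Set.Icc 0 t) := by
    intro t ht
    obtain ⟨C, hC⟩ := hf t ht
    refine ⟨C, ?_⟩
    rintro _ ⟨s, hs, rfl⟩
    exact hC s hs.1 hs.2
  refine ⟨fun t => max 1 (sSup (f '' Set.Icc 0 t)), ⟨fun s t hs hst => ?_,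
    fun t _ => le_max_left _ _⟩, fun t ht => ?_⟩
  · exact max_le_max le_rfl (csSup_le_csSup (bdd t (hs.trans hst))
      ⟨f s, s, ⟨hs, le_rfl⟩, rfl⟩ (Set.image_mono (Set.Icc_subset_Icc_right hst)))
  · exact (le_csSup (bdd t ht) ⟨t, ⟨ht, le_rfl⟩, rfl⟩).trans (le_max_right _ _)

theorem NondecOne.mul {M K : ℝ → ℝ} (hM : NondecOne M) (hK : NondecOne K) :
    NondecOne fun t => M t * K t := by
  refine ⟨fun s t hs hst => ?_, fun t ht => one_le_mul_of_one_le_of_one_le (hM.2 t ht) (hK.2 t ht)⟩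
  exact mul_le_mul (hM.1 s t hs hst) (hK.1 s t hs hst) (zero_le_one.trans (hK.2 s hs))
    (zero_le_one.trans (hM.2 t (hs.trans hst)))

/-- An estimate in terms of `‖P x‖` gives one in terms of `‖x‖` when `‖P‖` is bounded. -/
theorem le_mul_norm_of_le_mul_norm_apply {X : Type*} [NormedAddCommGroup X] [NormedSpace ℝ X]
    {P : X →L[ℝ] X} {a m h k : ℝ} {x : X} (hm : 1 ≤ m) (hh : 1 ≤ h) (hP : ‖P‖ ≤ k)
    (ha : a ≤ m * (h * ‖P x‖)) : a ≤ m * k * (h * ‖x‖) :=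
  calc a ≤ m * (h * ‖P x‖) := ha
    _ ≤ m * (h * (k * ‖x‖)) := by
      gcongr
      exact P.le_of_opNorm_le hP x
    _ = m * k * (h * ‖x‖) := by ring

/-- Proposition 2 (characterization of H-growth). -/
theorem prop_growth_characterization
    {X : Type*} [NormedAddCommGroup X] [NormedSpace ℝ X] [CompleteSpace X]
    (U V₂ V₃ : ℝ → ℝ → X →L[ℝ] X)
    (P₁ P₂ P₃ : ℝ → X →L[ℝ] X)
    (h₁ h₂ h₃ h₄ : ℝ → ℝ)
    -- U is an evolution operator
    (hU_id : ∀ t : ℝ, 0 ≤ t → U t t = 1)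
    (hU_cocycle : ∀ t s t₀ : ℝ, 0 ≤ t₀ → t₀ ≤ s → s ≤ t →
      U t t₀ = (U t s).comp (U s t₀))
    -- families of projectors
    (hP₁proj : ∀ t : ℝ, 0 ≤ t → (P₁ t).comp (P₁ t) = P₁ t)
    (hP₂proj : ∀ t : ℝ, 0 ≤ t → (P₂ t).comp (P₂ t) = P₂ t)
    (hP₃proj : ∀ t : ℝ, 0 ≤ t → (P₃ t).comp (P₃ t) = P₃ t)
    -- orthogonal family
    (hsum : ∀ t : ℝ, 0 ≤ t → P₁ t + P₂ t + P₃ t = 1)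
    (horth : ∀ t : ℝ, 0 ≤ t →
      (P₁ t).comp (P₂ t) = 0 ∧ (P₂ t).comp (P₁ t) = 0 ∧
      (P₁ t).comp (P₃ t) = 0 ∧ (P₃ t).comp (P₁ t) = 0 ∧
      (P₂ t).comp (P₃ t) = 0 ∧ (P₃ t).comp (P₂ t) = 0)
    -- invariance (compatibility)
    (hinv₁ : ∀ t s : ℝ, 0 ≤ s → s ≤ t → (U t s).comp (P₁ s) = (P₁ t).comp (U t s))
    (hinv₂ : ∀ t s : ℝ, 0 ≤ s → s ≤ t → (U t s).comp (P₂ s) = (P₂ t).comp (U t s))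
    (hinv₃ : ∀ t s : ℝ, 0 ≤ s → s ≤ t → (U t s).comp (P₃ s) = (P₃ t).comp (U t s))
    -- strong invariance of P₂, P₃, via the associated maps V₂, V₃
    (hV₂UV : ∀ (t s : ℝ) (x : X), 0 ≤ s → s ≤ t → U t s (V₂ t s (P₂ t x)) = P₂ t x)
    (hV₂VU : ∀ (t s : ℝ) (x : X), 0 ≤ s → s ≤ t → V₂ t s (U t s (P₂ s x)) = P₂ s x)
    (hV₂rng : ∀ (t s : ℝ) (x : X), 0 ≤ s → s ≤ t →
      V₂ t s (P₂ t x) = P₂ s (V₂ t s (P₂ t x)))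
    (hV₃UV : ∀ (t s : ℝ) (x : X), 0 ≤ s → s ≤ t → U t s (V₃ t s (P₃ t x)) = P₃ t x)
    (hV₃VU : ∀ (t s : ℝ) (x : X), 0 ≤ s → s ≤ t → V₃ t s (U t s (P₃ s x)) = P₃ s x)
    (hV₃rng : ∀ (t s : ℝ) (x : X), 0 ≤ s → s ≤ t →
      V₃ t s (P₃ t x) = P₃ s (V₃ t s (P₃ t x)))
    -- growth rates
    (hg₁ : GrowthRate h₁) (hg₂ : GrowthRate h₂)
    (hg₃ : GrowthRate h₃) (hg₄ : GrowthRate h₄)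
    -- boundedness of the projectors on compact time intervals
    (hbdd : ∀ t : ℝ, 0 ≤ t → ∃ C : ℝ, ∀ s : ℝ, 0 ≤ s → s ≤ t →
      ‖P₁ s‖ + ‖P₂ s‖ + ‖P₃ s‖ ≤ C)
    :
    (∃ M : ℝ → ℝ, NondecOne M ∧
      ∀ (t s : ℝ) (x : X), 0 ≤ s → s ≤ t →
        h₁ s * ‖U t s (P₁ s x)‖ ≤ M s * (h₁ t * ‖x‖) ∧
        h₂ s * ‖V₂ t s (P₂ t x)‖ ≤ M t * (h₂ t * ‖x‖) ∧
        h₃ s * ‖U t s (P₃ s x)‖ ≤ M s * (h₃ t * ‖x‖) ∧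
        h₄ s * ‖V₃ t s (P₃ t x)‖ ≤ M t * (h₄ t * ‖x‖)) ↔
    (∃ M : ℝ → ℝ, NondecOne M ∧
      ∀ (t s : ℝ) (x : X), 0 ≤ s → s ≤ t →
        h₁ s * ‖U t s (P₁ s x)‖ ≤ M s * (h₁ t * ‖P₁ s x‖) ∧
        h₂ s * ‖P₂ s x‖ ≤ M t * (h₂ t * ‖U t s (P₂ s x)‖) ∧
        h₃ s * ‖U t s (P₃ s x)‖ ≤ M s * (h₃ t * ‖P₃ s x‖) ∧
        h₄ s * ‖P₃ s x‖ ≤ M t * (h₄ t * ‖U t s (P₃ s x)‖)) := by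
  have idem : ∀ {P : ℝ → X →L[ℝ] X}, (∀ t : ℝ, 0 ≤ t → (P t).comp (P t) = P t) →
      ∀ s : ℝ, 0 ≤ s → ∀ x, P s (P s x) = P s x :=
    fun hP s hs x => DFunLike.congr_fun (hP s hs) x
  have range_U : ∀ {P : ℝ → X →L[ℝ] X}, (∀ t : ℝ, 0 ≤ t → (P t).comp (P t) = P t) →
      (∀ t s : ℝ, 0 ≤ s → s ≤ t → (U t s).comp (P s) = (P t).comp (U t s)) →
      ∀ t s : ℝ, 0 ≤ s → s ≤ t → ∀ x, P t (U t s (P s x)) = U t s (P s x) := by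
    intro P hP hinv t s hs hst x
    have h := DFunLike.congr_fun (hinv t s hs hst) (P s x)
    simp only [ContinuousLinearMap.comp_apply, idem hP s hs] at h
    exact h.symm
  constructor
  · rintro ⟨M, hM, hgrowth⟩
    refine ⟨M, hM, fun t s x hs hst => ⟨?_, ?_, ?_, ?_⟩⟩
    · simpa only [idem hP₁proj s hs] using (hgrowth t s (P₁ s x) hs hst).1
    · simpa only [range_U hP₂proj hinv₂ t s hs hst, hV₂VU t s x hs hst] using
        (hgrowth t s (U t s (P₂ s x)) hs hst).2.1
    · simpa only [idem hP₃proj s hs] using (hgrowth t s (P₃ s x) hs hst).2.2.1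
    · simpa only [range_U hP₃proj hinv₃ t s hs hst, hV₃VU t s x hs hst] using
        (hgrowth t s (U t s (P₃ s x)) hs hst).2.2.2
  · rintro ⟨M, hM, hgrowth⟩
    obtain ⟨K, hK, hPK⟩ := exists_nondecOne_majorant hbdd
    have hK₁ : ∀ t : ℝ, 0 ≤ t → ‖P₁ t‖ ≤ K t := fun t ht => by
      linarith [hPK t ht, norm_nonneg (P₂ t), norm_nonneg (P₃ t)]
    have hK₂ : ∀ t : ℝ, 0 ≤ t → ‖P₂ t‖ ≤ K t := fun t ht => by
      linarith [hPK t ht, norm_nonneg (P₁ t), norm_nonneg (P₃ t)]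
    have hK₃ : ∀ t : ℝ, 0 ≤ t → ‖P₃ t‖ ≤ K t := fun t ht => by
      linarith [hPK t ht, norm_nonneg (P₁ t), norm_nonneg (P₂ t)]
    refine ⟨fun t => M t * K t, hM.mul hK, fun t s x hs hst => ?_⟩
    have ht := hs.trans hst
    refine ⟨?_, ?_, ?_, ?_⟩
    · exact le_mul_norm_of_le_mul_norm_apply (hM.2 s hs) (hg₁.1.2 t ht) (hK₁ s hs)
        (hgrowth t s x hs hst).1
    · refine le_mul_norm_of_le_mul_norm_apply (hM.2 t ht) (hg₂.1.2 t ht) (hK₂ t ht) ?_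
      simpa only [← hV₂rng t s x hs hst, hV₂UV t s x hs hst] using
        (hgrowth t s (V₂ t s (P₂ t x)) hs hst).2.1
    · exact le_mul_norm_of_le_mul_norm_apply (hM.2 s hs) (hg₃.1.2 t ht) (hK₃ s hs)
        (hgrowth t s x hs hst).2.2.1
    · refine le_mul_norm_of_le_mul_norm_apply (hM.2 t ht) (hg₄.1.2 t ht) (hK₃ t ht) ?_
      simpa only [← hV₃rng t s x hs hst, hV₃UV t s x hs hst] using
        (hgrowth t s (V₃ t s (P₃ t x)) hs hst).2.2.2
end

section
/- If the pair (U,P) has H-growth with nondecreasing function M : ℝ₊ → [1,∞), then the function L : ℝ₊ × X → ℝ₊ defined by L(t,x) = sup_{τ ≥ t} (h₁(t)/h₁(τ))‖U(τ,t)P₁(t)x‖ + sup_{r ≤ t} (h₂(r)/h₂(t))‖V₂(t,r)P₂(t)x‖ + sup_{τ ≥ t} (h₃(t)/h₃(τ))‖U(τ,t)P₃(t)x‖ + sup_{r ≤ t} (h₄(r)/h₄(t))‖V₃(t,r)P₃(t)x‖ satisfies ‖x‖ ≤ L(t,x) ≤ 4M(t)‖x‖ for all (t,x) ∈ ℝ₊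 × X. -/
open Filter

theorem le_ciSup_and_ciSup_le {ι : Type*} {f : ι → ℝ} {a C : ℝ} (i : ι)
    (hi : f i = a) (hC : ∀ j, f j ≤ C) : a ≤ ⨆ j, f j ∧ ⨆ j, f j ≤ C :=
  haveI : Nonempty ι := ⟨i⟩
  ⟨hi ▸ le_ciSup ⟨C, Set.forall_mem_range.2 hC⟩ i, ciSup_le hC⟩

theorem div_mul_le_of_mul_le_mul {a b c m y : ℝ} (hb : 0 < b) (h : a * c ≤ m * (b * y)) :
    a / b * c ≤ m * y := by
  rw [div_mul_eq_mul_div, div_le_iff₀ hb]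
  linarith

theorem GrowthRate.pos {h : ℝ → ℝ} (hh : GrowthRate h) {t : ℝ} (ht : 0 ≤ t) : 0 < h t :=
  one_pos.trans_le (hh.1.2 t ht)

/-- Lemma: if (U,P) has H-growth then the canonical Lyapunov candidate L
satisfies `‖x‖ ≤ L(t,x) ≤ 4 M(t) ‖x‖`. -/
theorem lemma_L_bounds
    {X : Type*} [NormedAddCommGroup X] [NormedSpace ℝ X] [CompleteSpace X]
    (U V₂ V₃ : ℝ → ℝ → X →L[ℝ] X)
    (P₁ P₂ P₃ : ℝ → X →L[ℝ] X)
    (h₁ h₂ h₃ h₄ : ℝ → ℝ)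
    -- U is an evolution operator
    (hU_id : ∀ t : ℝ, 0 ≤ t → U t t = 1)
    (hU_cocycle : ∀ t s t₀ : ℝ, 0 ≤ t₀ → t₀ ≤ s → s ≤ t →
      U t t₀ = (U t s).comp (U s t₀))
    -- families of projectors
    (hP₁proj : ∀ t : ℝ, 0 ≤ t → (P₁ t).comp (P₁ t) = P₁ t)
    (hP₂proj : ∀ t : ℝ, 0 ≤ t → (P₂ t).comp (P₂ t) = P₂ t)
    (hP₃proj : ∀ t : ℝ, 0 ≤ t → (P₃ t).comp (P₃ t) = P₃ t)
    -- orthogonal family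
    (hsum : ∀ t : ℝ, 0 ≤ t → P₁ t + P₂ t + P₃ t = 1)
    (horth : ∀ t : ℝ, 0 ≤ t →
      (P₁ t).comp (P₂ t) = 0 ∧ (P₂ t).comp (P₁ t) = 0 ∧
      (P₁ t).comp (P₃ t) = 0 ∧ (P₃ t).comp (P₁ t) = 0 ∧
      (P₂ t).comp (P₃ t) = 0 ∧ (P₃ t).comp (P₂ t) = 0)
    -- invariance (compatibility)
    (hinv₁ : ∀ t s : ℝ, 0 ≤ s → s ≤ t → (U t s).comp (P₁ s) = (P₁ t).comp (U t s))
    (hinv₂ : ∀ t s : ℝ, 0 ≤ s → s ≤ t → (U t s).comp (P₂ s) = (P₂ t).comp (U t s))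
    (hinv₃ : ∀ t s : ℝ, 0 ≤ s → s ≤ t → (U t s).comp (P₃ s) = (P₃ t).comp (U t s))
    -- strong invariance of P₂, P₃, via the associated maps V₂, V₃
    (hV₂UV : ∀ (t s : ℝ) (x : X), 0 ≤ s → s ≤ t → U t s (V₂ t s (P₂ t x)) = P₂ t x)
    (hV₂VU : ∀ (t s : ℝ) (x : X), 0 ≤ s → s ≤ t → V₂ t s (U t s (P₂ s x)) = P₂ s x)
    (hV₂rng : ∀ (t s : ℝ) (x : X), 0 ≤ s → s ≤ t →
      V₂ t s (P₂ t x) = P₂ s (V₂ t s (P₂ t x)))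
    (hV₃UV : ∀ (t s : ℝ) (x : X), 0 ≤ s → s ≤ t → U t s (V₃ t s (P₃ t x)) = P₃ t x)
    (hV₃VU : ∀ (t s : ℝ) (x : X), 0 ≤ s → s ≤ t → V₃ t s (U t s (P₃ s x)) = P₃ s x)
    (hV₃rng : ∀ (t s : ℝ) (x : X), 0 ≤ s → s ≤ t →
      V₃ t s (P₃ t x) = P₃ s (V₃ t s (P₃ t x)))
    -- growth rates
    (hg₁ : GrowthRate h₁) (hg₂ : GrowthRate h₂)
    (hg₃ : GrowthRate h₃) (hg₄ : GrowthRate h₄)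
    -- (U, P) has H-growth with nondecreasing M
    (M : ℝ → ℝ) (hM : NondecOne M)
    (hgrowth : ∀ (t s : ℝ) (x : X), 0 ≤ s → s ≤ t →
            h₁ s * ‖U t s (P₁ s x)‖ ≤ M s * (h₁ t * ‖x‖) ∧
            h₂ s * ‖V₂ t s (P₂ t x)‖ ≤ M t * (h₂ t * ‖x‖) ∧
            h₃ s * ‖U t s (P₃ s x)‖ ≤ M s * (h₃ t * ‖x‖) ∧
            h₄ s * ‖V₃ t s (P₃ t x)‖ ≤ M t * (h₄ t * ‖x‖))
    -- the function L
    (L : ℝ → X → ℝ)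
    (hL : ∀ (t : ℝ) (x : X), 0 ≤ t → L t x =
        (⨆ τ : {τ : ℝ // t ≤ τ}, h₁ t / h₁ τ.1 * ‖U τ.1 t (P₁ t x)‖) +
        (⨆ r : {r : ℝ // 0 ≤ r ∧ r ≤ t}, h₂ r.1 / h₂ t * ‖V₂ t r.1 (P₂ t x)‖) +
        (⨆ τ : {τ : ℝ // t ≤ τ}, h₃ t / h₃ τ.1 * ‖U τ.1 t (P₃ t x)‖) +
        (⨆ r : {r : ℝ // 0 ≤ r ∧ r ≤ t}, h₄ r.1 / h₄ t * ‖V₃ t r.1 (P₃ t x)‖)) :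
    ∀ (t : ℝ) (x : X), 0 ≤ t → ‖x‖ ≤ L t x ∧ L t x ≤ 4 * M t * ‖x‖ := by
  intro t x ht
  have hU : ∀ y, U t t y = y := fun y => by simp [hU_id t ht]
  have hV₂ : V₂ t t (P₂ t x) = P₂ t x := by simpa only [hU] using hV₂UV t t x ht le_rfl
  have hV₃ : V₃ t t (P₃ t x) = P₃ t x := by simpa only [hU] using hV₃UV t t x ht le_rfl
  obtain ⟨lower₁, upper₁⟩ := le_ciSup_and_ciSup_le (a := ‖P₁ t x‖) (C := M t * ‖x‖)
    (f := fun τ : {τ : ℝ // t ≤ τ} => h₁ t / h₁ τ.1 * ‖U τ.1 t (P₁ t x)‖) ⟨t, le_rfl⟩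
    (by simp [hU, (hg₁.pos ht).ne'])
    (fun τ => div_mul_le_of_mul_le_mul (hg₁.pos (ht.trans τ.2)) (hgrowth τ t x ht τ.2).1)
  obtain ⟨lower₂, upper₂⟩ := le_ciSup_and_ciSup_le (a := ‖P₂ t x‖) (C := M t * ‖x‖)
    (f := fun r : {r : ℝ // 0 ≤ r ∧ r ≤ t} => h₂ r.1 / h₂ t * ‖V₂ t r.1 (P₂ t x)‖)
    ⟨t, ht, le_rfl⟩ (by simp [hV₂, (hg₂.pos ht).ne'])
    (fun r => div_mul_le_of_mul_le_mul (hg₂.pos ht) (hgrowth t r x r.2.1 r.2.2).2.1)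
  obtain ⟨lower₃, upper₃⟩ := le_ciSup_and_ciSup_le (a := ‖P₃ t x‖) (C := M t * ‖x‖)
    (f := fun τ : {τ : ℝ // t ≤ τ} => h₃ t / h₃ τ.1 * ‖U τ.1 t (P₃ t x)‖) ⟨t, le_rfl⟩
    (by simp [hU, (hg₃.pos ht).ne'])
    (fun τ => div_mul_le_of_mul_le_mul (hg₃.pos (ht.trans τ.2)) (hgrowth τ t x ht τ.2).2.2.1)
  obtain ⟨lower₄, upper₄⟩ := le_ciSup_and_ciSup_le (a := ‖P₃ t x‖) (C := M t * ‖x‖)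
    (f := fun r : {r : ℝ // 0 ≤ r ∧ r ≤ t} => h₄ r.1 / h₄ t * ‖V₃ t r.1 (P₃ t x)‖)
    ⟨t, ht, le_rfl⟩ (by simp [hV₃, (hg₄.pos ht).ne'])
    (fun r => div_mul_le_of_mul_le_mul (hg₄.pos ht) (hgrowth t r x r.2.1 r.2.2).2.2.2)
  have hx : ‖x‖ ≤ ‖P₁ t x‖ + ‖P₂ t x‖ + ‖P₃ t x‖ := by
    have hPx : P₁ t x + P₂ t x + P₃ t x = x := by
      simpa using DFunLike.congr_fun (hsum t ht) x
    simpa only [hPx] using norm_add₃_le (a := P₁ t x) (b := P₂ t x) (c := P₃ t x)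
  rw [hL t x ht]
  constructor <;> linarith [norm_nonneg (P₃ t x)]
end

section
/- If L : ℝ₊ × X → ℝ₊ is an H-Lyapunov function for (U,P) with nondecreasing function T : ℝ₊ → [1,∞), then the pair (U,P) is H-trichotomic; in fact for all (t,s) ∈ Δ and x ∈ X: h₁(t)‖U(t,s)P₁(s)x‖ ≤ T(s)²h₁(s)‖x‖, h₂(t)‖V₂(t,s)P₂(t)x‖ ≤ T(t)²h₂(s)‖x‖, h₃(s)‖U(t,s)P₃(s)x‖ ≤ T(s)²h₃(t)‖x‖, and h₄(s)‖V₃(t,s)P₃(t)x‖ ≤ T(t)²h₄(t)‖x‖. -/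
open Filter

/-- If L is an H-Lyapunov function for (U,P) with nondecreasing T, then
(U,P) is H-trichotomic; in fact the trichotomy estimates hold with T². -/
theorem thm_lyapunov_implies_trichotomy
    {X : Type*} [NormedAddCommGroup X] [NormedSpace ℝ X] [CompleteSpace X]
    (U V₂ V₃ : ℝ → ℝ → X →L[ℝ] X)
    (P₁ P₂ P₃ : ℝ → X →L[ℝ] X)
    (h₁ h₂ h₃ h₄ : ℝ → ℝ)
    -- U is an evolution operator
    (hU_id : ∀ t : ℝ, 0 ≤ t → U t t = 1)
    (hU_cocycle : ∀ t s t₀ : ℝ, 0 ≤ t₀ → t₀ ≤ s → s ≤ t →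
      U t t₀ = (U t s).comp (U s t₀))
    -- families of projectors
    (hP₁proj : ∀ t : ℝ, 0 ≤ t → (P₁ t).comp (P₁ t) = P₁ t)
    (hP₂proj : ∀ t : ℝ, 0 ≤ t → (P₂ t).comp (P₂ t) = P₂ t)
    (hP₃proj : ∀ t : ℝ, 0 ≤ t → (P₃ t).comp (P₃ t) = P₃ t)
    -- orthogonal family
    (hsum : ∀ t : ℝ, 0 ≤ t → P₁ t + P₂ t + P₃ t = 1)
    (horth : ∀ t : ℝ, 0 ≤ t →
      (P₁ t).comp (P₂ t) = 0 ∧ (P₂ t).comp (P₁ t) = 0 ∧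
      (P₁ t).comp (P₃ t) = 0 ∧ (P₃ t).comp (P₁ t) = 0 ∧
      (P₂ t).comp (P₃ t) = 0 ∧ (P₃ t).comp (P₂ t) = 0)
    -- invariance (compatibility)
    (hinv₁ : ∀ t s : ℝ, 0 ≤ s → s ≤ t → (U t s).comp (P₁ s) = (P₁ t).comp (U t s))
    (hinv₂ : ∀ t s : ℝ, 0 ≤ s → s ≤ t → (U t s).comp (P₂ s) = (P₂ t).comp (U t s))
    (hinv₃ : ∀ t s : ℝ, 0 ≤ s → s ≤ t → (U t s).comp (P₃ s) = (P₃ t).comp (U t s))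
    -- strong invariance of P₂, P₃, via the associated maps V₂, V₃
    (hV₂UV : ∀ (t s : ℝ) (x : X), 0 ≤ s → s ≤ t → U t s (V₂ t s (P₂ t x)) = P₂ t x)
    (hV₂VU : ∀ (t s : ℝ) (x : X), 0 ≤ s → s ≤ t → V₂ t s (U t s (P₂ s x)) = P₂ s x)
    (hV₂rng : ∀ (t s : ℝ) (x : X), 0 ≤ s → s ≤ t →
      V₂ t s (P₂ t x) = P₂ s (V₂ t s (P₂ t x)))
    (hV₃UV : ∀ (t s : ℝ) (x : X), 0 ≤ s → s ≤ t → U t s (V₃ t s (P₃ t x)) = P₃ t x)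
    (hV₃VU : ∀ (t s : ℝ) (x : X), 0 ≤ s → s ≤ t → V₃ t s (U t s (P₃ s x)) = P₃ s x)
    (hV₃rng : ∀ (t s : ℝ) (x : X), 0 ≤ s → s ≤ t →
      V₃ t s (P₃ t x) = P₃ s (V₃ t s (P₃ t x)))
    -- growth rates
    (hg₁ : GrowthRate h₁) (hg₂ : GrowthRate h₂)
    (hg₃ : GrowthRate h₃) (hg₄ : GrowthRate h₄)
    -- L is an H-Lyapunov function with nondecreasing T
    (L : ℝ → X → ℝ) (T : ℝ → ℝ) (hT : NondecOne T)
    (hL0 : ∀ (t : ℝ) (x : X), 0 ≤ t → ‖x‖ ≤ L t x ∧ L t x ≤ T t * ‖x‖)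
    (hLyap : ∀ (t s : ℝ) (x : X), 0 ≤ s → s ≤ t →
            h₁ t * L t (U t s (P₁ s x)) ≤ T s * (h₁ s * L s x) ∧
            h₂ t * L s (V₂ t s (P₂ t x)) ≤ T t * (h₂ s * L t x) ∧
            h₃ s * L t (U t s (P₃ s x)) ≤ T s * (h₃ t * L s x) ∧
            h₄ s * L s (V₃ t s (P₃ t x)) ≤ T t * (h₄ t * L t x)) :
    (∃ N : ℝ → ℝ, NondecOne N ∧
      ∀ (t s : ℝ) (x : X), 0 ≤ s → s ≤ t →
        h₁ t * ‖U t s (P₁ s x)‖ ≤ N s * (h₁ s * ‖x‖) ∧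
        h₂ t * ‖V₂ t s (P₂ t x)‖ ≤ N t * (h₂ s * ‖x‖) ∧
        h₃ s * ‖U t s (P₃ s x)‖ ≤ N s * (h₃ t * ‖x‖) ∧
        h₄ s * ‖V₃ t s (P₃ t x)‖ ≤ N t * (h₄ t * ‖x‖)) ∧
    ∀ (t s : ℝ) (x : X), 0 ≤ s → s ≤ t →
      h₁ t * ‖U t s (P₁ s x)‖ ≤ (T s) ^ 2 * (h₁ s * ‖x‖) ∧
      h₂ t * ‖V₂ t s (P₂ t x)‖ ≤ (T t) ^ 2 * (h₂ s * ‖x‖) ∧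
      h₃ s * ‖U t s (P₃ s x)‖ ≤ (T s) ^ 2 * (h₃ t * ‖x‖) ∧
      h₄ s * ‖V₃ t s (P₃ t x)‖ ≤ (T t) ^ 2 * (h₄ t * ‖x‖) := by
  have nonneg {h : ℝ → ℝ} (hg : GrowthRate h) {t : ℝ} (ht : 0 ≤ t) : 0 ≤ h t :=
    zero_le_one.trans (hg.1.2 t ht)
  suffices H : ∀ (t s : ℝ) (x : X), 0 ≤ s → s ≤ t →
      h₁ t * ‖U t s (P₁ s x)‖ ≤ (T s) ^ 2 * (h₁ s * ‖x‖) ∧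
      h₂ t * ‖V₂ t s (P₂ t x)‖ ≤ (T t) ^ 2 * (h₂ s * ‖x‖) ∧
      h₃ s * ‖U t s (P₃ s x)‖ ≤ (T s) ^ 2 * (h₃ t * ‖x‖) ∧
      h₄ s * ‖V₃ t s (P₃ t x)‖ ≤ (T t) ^ 2 * (h₄ t * ‖x‖) by
    refine ⟨⟨fun t => T t ^ 2, ⟨fun s t hs hst => ?_, fun t ht => ?_⟩, H⟩, H⟩
    · exact pow_le_pow_left₀ (zero_le_one.trans (hT.2 s hs)) (hT.1 s t hs hst) 2
    · exact one_le_pow₀ (hT.2 t ht)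
  intro t s x hs hst
  have ht := hs.trans hst
  have bound {r q a b : ℝ} {y : X} (hr : 0 ≤ r) (hq : 0 ≤ q) (ha : 0 ≤ a) (hb : 0 ≤ b)
      (h : a * L r y ≤ T q * (b * L q x)) : a * ‖y‖ ≤ T q ^ 2 * (b * ‖x‖) := by
    have hTq : 0 ≤ T q := zero_le_one.trans (hT.2 q hq)
    calc a * ‖y‖ ≤ a * L r y := mul_le_mul_of_nonneg_left (hL0 r y hr).1 ha
      _ ≤ T q * (b * L q x) := h
      _ ≤ T q * (b * (T q * ‖x‖)) :=
        mul_le_mul_of_nonneg_left (mul_le_mul_of_nonneg_left (hL0 q x hq).2 hb) hTq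
      _ = T q ^ 2 * (b * ‖x‖) := by ring
  obtain ⟨e₁, e₂, e₃, e₄⟩ := hLyap t s x hs hst
  exact ⟨bound ht hs (nonneg hg₁ ht) (nonneg hg₁ hs) e₁,
    bound hs ht (nonneg hg₂ ht) (nonneg hg₂ hs) e₂,
    bound ht hs (nonneg hg₃ hs) (nonneg hg₃ ht) e₃,
    bound hs ht (nonneg hg₄ hs) (nonneg hg₄ ht) e₄⟩
end

section
/- Let P₁, P₂, P₃ ∈ B(X) be fixed orthogonal projections (P₁+P₂+P₃ = I, P_i² = P_i, P_iP_j = 0 for i ≠ j) with P₂ ≠ 0, and define U(t,s) = (h₁(s)²/h₁(t)²)P₁ + (h₂(s)²/h₂(t)²)P₂ + (h₂(s)³h₃(t)h₄(s))/(h₂(t)³h₃(s)h₄(t))P₃ for (t,s) ∈ Δ, with V₂(t,s)x = (h₂(t)²/h₂(s)²)P₂x. Then there is no constant M ≥ 1 such that h₂(s)‖V₂(t,s)P₂x‖ ≤ M h₂(t)‖x‖ for all (t,s) ∈ Δ and x ∈ X; consequently the pair (U,{P₁,P₂,P₃}) does not have uniform H-growth (and hence is not uniformly H-trichotomic). -/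
open Filter

/-- For a growth rate `h` and a nonzero idempotent `P`, the family
`(h t ^ 2 / h s ^ 2) • P` does not have uniform `h`-growth on the range of `P`. -/
theorem GrowthRate.not_exists_uniform_bound {X : Type*} [NormedAddCommGroup X] [NormedSpace ℝ X]
    {P : X →L[ℝ] X} (hproj : P.comp P = P) (hne : P ≠ 0) {h : ℝ → ℝ} (hg : GrowthRate h)
    {V : ℝ → ℝ → X →L[ℝ] X}
    (hV : ∀ t s : ℝ, 0 ≤ s → s ≤ t → V t s = ((h t) ^ 2 / (h s) ^ 2) • P) :
    ¬ ∃ M : ℝ, 1 ≤ M ∧ ∀ (t s : ℝ) (x : X), 0 ≤ s → s ≤ t →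
      h s * ‖V t s (P x)‖ ≤ M * (h t * ‖x‖) := by
  rintro ⟨M, -, hM⟩
  obtain ⟨x, hx⟩ : ∃ x, P x ≠ 0 := by
    by_contra! hzero
    exact hne (ContinuousLinearMap.ext hzero)
  have hfix (y : X) : P (P y) = P y := DFunLike.congr_fun hproj y
  have hpos : 0 < ‖P x‖ := norm_pos_iff.mpr hx
  obtain ⟨t, hlarge, ht⟩ :=
    ((hg.2.eventually_gt_atTop (M * h 0)).and (eventually_ge_atTop 0)).exists
  have hb : 0 < h 0 := zero_lt_one.trans_le (hg.1.2 0 le_rfl)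
  have ha : 0 < h t := zero_lt_one.trans_le (hg.1.2 t ht)
  have hbound := hM t 0 (P x) le_rfl ht
  rw [hV t 0 le_rfl ht, smul_apply, hfix, hfix, norm_smul,
    Real.norm_of_nonneg (by positivity)] at hbound
  have hscalar : h t / h 0 * (h t * ‖P x‖) ≤ M * (h t * ‖P x‖) := by
    convert hbound using 1
    field_simp
  have hle := le_of_mul_le_mul_right hscalar (by positivity)
  rw [div_le_iff₀ hb] at hle
  exact hlarge.not_ge hle

/-- Example 2, negative part: the pair (U, P) of Example 2 does not have
uniform H-growth (hence is not uniformly H-trichotomic). -/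
theorem example2_not_uniform_growth
    {X : Type*} [NormedAddCommGroup X] [NormedSpace ℝ X] [CompleteSpace X]
    (P₁ P₂ P₃ : X →L[ℝ] X)
    (hP₁proj : P₁.comp P₁ = P₁) (hP₂proj : P₂.comp P₂ = P₂)
    (hP₃proj : P₃.comp P₃ = P₃)
    (hsum : P₁ + P₂ + P₃ = 1)
    (h12 : P₁.comp P₂ = 0) (h21 : P₂.comp P₁ = 0)
    (h13 : P₁.comp P₃ = 0) (h31 : P₃.comp P₁ = 0)
    (h23 : P₂.comp P₃ = 0) (h32 : P₃.comp P₂ = 0)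
    (h₁ h₂ h₃ h₄ : ℝ → ℝ)
    (hg₁ : GrowthRate h₁) (hg₂ : GrowthRate h₂)
    (hg₃ : GrowthRate h₃) (hg₄ : GrowthRate h₄)
    (U V₂ V₃ : ℝ → ℝ → X →L[ℝ] X)
    (hU : ∀ t s : ℝ, 0 ≤ s → s ≤ t →
      U t s = ((h₁ s) ^ 2 / (h₁ t) ^ 2) • P₁ + ((h₂ s) ^ 2 / (h₂ t) ^ 2) • P₂ +
        (((h₂ s) ^ 3 * h₃ t * h₄ s) / ((h₂ t) ^ 3 * h₃ s * h₄ t)) • P₃)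
    (hV₂ : ∀ t s : ℝ, 0 ≤ s → s ≤ t → V₂ t s = ((h₂ t) ^ 2 / (h₂ s) ^ 2) • P₂)
    (hV₃ : ∀ t s : ℝ, 0 ≤ s → s ≤ t →
      V₃ t s = (((h₂ t) ^ 3 * h₃ s * h₄ t) / ((h₂ s) ^ 3 * h₃ t * h₄ s)) • P₃)
    (hP₂ne : P₂ ≠ 0) :
    (¬ ∃ M : ℝ, 1 ≤ M ∧ ∀ (t s : ℝ) (x : X), 0 ≤ s → s ≤ t →
        h₂ s * ‖V₂ t s (P₂ x)‖ ≤ M * (h₂ t * ‖x‖)) ∧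
    (¬ ∃ M : ℝ, 1 ≤ M ∧
      ∀ (t s : ℝ) (x : X), 0 ≤ s → s ≤ t →
        h₁ s * ‖U t s (P₁ x)‖ ≤ M * (h₁ t * ‖x‖) ∧
        h₂ s * ‖V₂ t s (P₂ x)‖ ≤ M * (h₂ t * ‖x‖) ∧
        h₃ s * ‖U t s (P₃ x)‖ ≤ M * (h₃ t * ‖x‖) ∧
        h₄ s * ‖V₃ t s (P₃ x)‖ ≤ M * (h₄ t * ‖x‖)) ∧
    (¬ ∃ N : ℝ, 1 ≤ N ∧
      ∀ (t s : ℝ) (x : X), 0 ≤ s → s ≤ t →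
        h₁ t * ‖U t s (P₁ x)‖ ≤ N * (h₁ s * ‖x‖) ∧
        h₂ t * ‖V₂ t s (P₂ x)‖ ≤ N * (h₂ s * ‖x‖) ∧
        h₃ s * ‖U t s (P₃ x)‖ ≤ N * (h₃ t * ‖x‖) ∧
        h₄ s * ‖V₃ t s (P₃ x)‖ ≤ N * (h₄ t * ‖x‖)) := by
  have hmain := hg₂.not_exists_uniform_bound hP₂proj hP₂ne hV₂
  refine ⟨hmain, ?_, ?_⟩
  · rintro ⟨M, hM, hbound⟩
    exact hmain ⟨M, hM, fun t s x hs hst => (hbound t s x hs hst).2.1⟩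
  · rintro ⟨N, hN, hbound⟩
    refine hmain ⟨N, hN, fun t s x hs hst => ?_⟩
    have hmono := hg₂.1.1 s t hs hst
    calc h₂ s * ‖V₂ t s (P₂ x)‖ ≤ h₂ t * ‖V₂ t s (P₂ x)‖ := by gcongr
      _ ≤ N * (h₂ s * ‖x‖) := (hbound t s x hs hst).2.1
      _ ≤ N * (h₂ t * ‖x‖) := by gcongr
end
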